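/- Let G₁ be the graph on vertices {a,b,c,d} with edges ab, ac, bc, ad, bd (K₄ minus one edge); let G₂ be the graph on {a,b,c,d,e,f} with edges ab, ac, bc, cd, ae, bf (a triangle abc with a pendant vertex attached to each of its vertices); let G₃ be the graph on {a,b,c,d,e,f} with edges ab, ac, bc, ad, de, be, ef; and let G₄ be the graph on {a,b,c,d,e,f,h,k} with edges ab, ac, bc, ad, be, df, ef, dh, ek. Then any finite simple graph that contains at least one of G₁, G₂, G₃, G₄ as a subgraph admits no vi-simultaneous proper 5-coloring, i.e., χ_vi(G) ≥ 6. In particular, every outerplanar cubic (3-regular) graph G containing one of these subgraphs satisfies χ_vi(G) = 6. -/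

import Mathlib

open SimpleGraph

variable {V : Type*}

/-- `(v, e)` is an incidence of `G`: `e` is an edge of `G` and `v ∈ e`. -/
def SimpleGraph.IsIncidence (G : SimpleGraph V) (v : V) (e : Sym2 V) : Prop :=
  e ∈ G.edgeSet ∧ v ∈ e

/-- A vi-simultaneous proper `k`-coloring of `G`, given by a coloring `cV` of the vertices
and a coloring `cI` of the incidences (the value of `cI v e` matters only when `(v, e)` is
an incidence of `G`). -/
structure SimpleGraph.IsViColoring (G : SimpleGraph V) (k : ℕ)
    (cV : V → Fin k) (cI : V → Sym2 V → Fin k) : Prop where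
  /-- adjacent vertices receive distinct colors -/
  adj_ne : ∀ ⦃u v⦄, G.Adj u v → cV u ≠ cV v
  /-- a vertex `u` and an incidence `(w, f)` with `u ∈ f` receive distinct colors -/
  vertex_inc_ne : ∀ ⦃u w f⦄, G.IsIncidence w f → u ∈ f → cV u ≠ cI w f
  /-- two distinct incidences `(v, e)` and `(w, f)` receive distinct colors whenever
  `v = w`, or `e = f`, or the edge `{v, w}` equals `e` or `f` -/
  inc_ne : ∀ ⦃v e w f⦄, G.IsIncidence v e → G.IsIncidence w f → (v, e) ≠ (w, f) →
    (v = w ∨ e = f ∨ s(v, w) = e ∨ s(v, w) = f) → cI v e ≠ cI w f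

/-- The set of colors appearing on the second incidences
`I_2(u) = {(v, {u, v}) : v adjacent to u}` of a vertex `u`. -/
def SimpleGraph.secondIncColors (G : SimpleGraph V) {k : ℕ}
    (cI : V → Sym2 V → Fin k) (u : V) : Set (Fin k) :=
  {a | ∃ v, G.Adj u v ∧ cI v s(u, v) = a}

/-- The vi-simultaneous chromatic number `χ_vi(G)`. -/
noncomputable def SimpleGraph.chiVi (G : SimpleGraph V) : ℕ :=
  sInf {k | ∃ cV cI, G.IsViColoring k cV cI}

/-- `χ_{vi,s}(G)`: the least `k` admitting a vi-simultaneous `(k, s)`-coloring, i.e. a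
vi-simultaneous proper `k`-coloring using at most `s` colors on `I_2(v)` for each vertex `v`. -/
noncomputable def SimpleGraph.chiViS (G : SimpleGraph V) (s : ℕ) : ℕ :=
  sInf {k | ∃ cV cI, G.IsViColoring k cV cI ∧
    ∀ u, (G.secondIncColors cI u).ncard ≤ s}

/-- `G` is outerplanar: there is a linear ordering of the vertices such that no two edges
`{a, b}` and `{c, d}` satisfy `a < c < b < d`. -/
def SimpleGraph.Outerplanar (G : SimpleGraph V) : Prop :=
  ∃ r : LinearOrder V, ∀ a b c d : V, G.Adj a b → G.Adj c d →
    ¬(r.lt a c ∧ r.lt c b ∧ r.lt b d)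

/-- The maximum degree `Δ(G)` of a finite graph. -/
noncomputable def SimpleGraph.maxDeg (G : SimpleGraph V) [Fintype V] : ℕ :=
  Finset.univ.sup fun v => (G.neighborSet v).ncard

/-- `G` is 2-connected: it has at least 3 vertices, is connected, and deleting any single
vertex leaves it connected. -/
def SimpleGraph.TwoConnected (G : SimpleGraph V) [Fintype V] : Prop :=
  3 ≤ Fintype.card V ∧ G.Connected ∧
    ∀ v : V, (((⊤ : G.Subgraph).deleteVerts {v}).coe).Connected

/-- `G` contains `H` as a subgraph. -/
def SimpleGraph.ContainsSub {W X : Type*} (G : SimpleGraph W) (H : SimpleGraph X) : Prop :=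
  ∃ f : X → W, Function.Injective f ∧ ∀ ⦃i j⦄, H.Adj i j → G.Adj (f i) (f j)

/-- `G₁`: vertices `a, b, c, d = 0, 1, 2, 3`, edges `ab, ac, bc, ad, bd` (`K₄` minus an edge). -/
def graphG1 : SimpleGraph (Fin 4) :=
  SimpleGraph.fromRel fun i j =>
    ((i, j) : Fin 4 × Fin 4) ∈ [(0, 1), (0, 2), (1, 2), (0, 3), (1, 3)]

/-- `G₂`: vertices `a, b, c, d, e, f = 0, …, 5`, edges `ab, ac, bc, cd, ae, bf`. -/
def graphG2 : SimpleGraph (Fin 6) :=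
  SimpleGraph.fromRel fun i j =>
    ((i, j) : Fin 6 × Fin 6) ∈ [(0, 1), (0, 2), (1, 2), (2, 3), (0, 4), (1, 5)]

/-- `G₃`: vertices `a, b, c, d, e, f = 0, …, 5`, edges `ab, ac, bc, ad, de, be, ef`. -/
def graphG3 : SimpleGraph (Fin 6) :=
  SimpleGraph.fromRel fun i j =>
    ((i, j) : Fin 6 × Fin 6) ∈ [(0, 1), (0, 2), (1, 2), (0, 3), (3, 4), (1, 4), (4, 5)]

/-- `G₄`: vertices `a, b, c, d, e, f, h, k = 0, …, 7`,
edges `ab, ac, bc, ad, be, df, ef, dh, ek`. -/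
def graphG4 : SimpleGraph (Fin 8) :=
  SimpleGraph.fromRel fun i j =>
    ((i, j) : Fin 8 × Fin 8) ∈
      [(0, 1), (0, 2), (1, 2), (0, 3), (1, 4), (3, 5), (4, 5), (3, 6), (4, 7)]

namespace SimpleGraph

section FiveColors

variable {G : SimpleGraph V} {k : ℕ} {cV : V → Fin k} {cI : V → Sym2 V → Fin k}

theorem isIncidence_of_adj {u v : V} (h : G.Adj u v) : G.IsIncidence u s(u, v) :=
  ⟨h, Sym2.mem_mk_left u v⟩

theorem IsViColoring.vertex_ne_first (hc : G.IsViColoring k cV cI) {u v : V} (h : G.Adj u v) :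
    cV u ≠ cI u s(u, v) :=
  hc.vertex_inc_ne (isIncidence_of_adj h) (Sym2.mem_mk_left u v)

theorem IsViColoring.vertex_ne_second (hc : G.IsViColoring k cV cI) {u v : V} (h : G.Adj u v) :
    cV u ≠ cI v s(v, u) :=
  hc.vertex_inc_ne (isIncidence_of_adj h.symm) (Sym2.mem_mk_right v u)

theorem IsViColoring.first_ne_first (hc : G.IsViColoring k cV cI) {u v w : V}
    (hv : G.Adj u v) (hw : G.Adj u w) (hvw : v ≠ w) : cI u s(u, v) ≠ cI u s(u, w) :=
  hc.inc_ne (isIncidence_of_adj hv) (isIncidence_of_adj hw)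
    (fun h => hvw (Sym2.congr_right.1 (congrArg Prod.snd h))) (Or.inl rfl)

theorem IsViColoring.first_ne_second (hc : G.IsViColoring k cV cI) {u v w : V}
    (hv : G.Adj u v) (hw : G.Adj u w) : cI u s(u, v) ≠ cI w s(w, u) :=
  hc.inc_ne (isIncidence_of_adj hv) (isIncidence_of_adj hw.symm)
    (fun h => hw.ne (congrArg Prod.fst h)) (Or.inr (Or.inr (Or.inr Sym2.eq_swap)))

theorem eq_of_ne_four : ∀ p q r s x y : Fin 5, p ≠ q → p ≠ r → p ≠ s → q ≠ r → q ≠ s → r ≠ s →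
    p ≠ x → q ≠ x → r ≠ x → s ≠ x → p ≠ y → q ≠ y → r ≠ y → s ≠ y → x = y := by
  intro p q r s x y hpq hpr hps hqr hqs hrs hpx hqx hrx hsx hpy hqy hry hsy
  by_contra hxy
  have h : ({p, q, r, s, x, y} : Finset (Fin 5)).card = 6 := by simp [*]
  have := h.symm.trans_le (Finset.card_le_univ _)
  simp at this

/-- `u` has the three distinct neighbors `v₁`, `v₂`, `v₃`. -/
structure HasThreeNeighbors (G : SimpleGraph V) (u v₁ v₂ v₃ : V) : Prop where
  adj₁ : G.Adj u v₁
  adj₂ : G.Adj u v₂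
  adj₃ : G.Adj u v₃
  ne₁₂ : v₁ ≠ v₂
  ne₁₃ : v₁ ≠ v₃
  ne₂₃ : v₂ ≠ v₃

variable {cV : V → Fin 5} {cI : V → Sym2 V → Fin 5}

/-- In a 5-coloring, all second incidences of a vertex of degree three have the same color. -/
theorem IsViColoring.second_eq_second (hc : G.IsViColoring 5 cV cI) {u v₁ v₂ v₃ w w' : V}
    (h : G.HasThreeNeighbors u v₁ v₂ v₃) (hw : G.Adj u w) (hw' : G.Adj u w') :
    cI w s(w, u) = cI w' s(w', u) :=
  eq_of_ne_four (cV u) (cI u s(u, v₁)) (cI u s(u, v₂)) (cI u s(u, v₃)) _ _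
    (hc.vertex_ne_first h.adj₁) (hc.vertex_ne_first h.adj₂) (hc.vertex_ne_first h.adj₃)
    (hc.first_ne_first h.adj₁ h.adj₂ h.ne₁₂) (hc.first_ne_first h.adj₁ h.adj₃ h.ne₁₃)
    (hc.first_ne_first h.adj₂ h.adj₃ h.ne₂₃)
    (hc.vertex_ne_second hw) (hc.first_ne_second h.adj₁ hw) (hc.first_ne_second h.adj₂ hw)
    (hc.first_ne_second h.adj₃ hw)
    (hc.vertex_ne_second hw') (hc.first_ne_second h.adj₁ hw') (hc.first_ne_second h.adj₂ hw')
    (hc.first_ne_second h.adj₃ hw')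

/-- In a 5-coloring, if `a b c` is a triangle and `a`, `b` have further neighbors `d`, `e`,
then the incidence `(a, ad)` has the color of `c`. -/
theorem IsViColoring.vertex_eq_first_of_triangle (hc : G.IsViColoring 5 cV cI) {a b c d e : V}
    (ha : G.HasThreeNeighbors a b c d) (hb : G.HasThreeNeighbors b a c e) :
    cV c = cI a s(a, d) := by
  have hac : cI b s(b, a) = cI c s(c, a) := hc.second_eq_second ha ha.adj₁ ha.adj₂
  have hbc : cI a s(a, b) = cI c s(c, b) := hc.second_eq_second hb hb.adj₁ hb.adj₂
  refine eq_of_ne_four (cV a) (cI a s(a, b)) (cI a s(a, c)) (cI b s(b, a)) _ _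
    (hc.vertex_ne_first ha.adj₁) (hc.vertex_ne_first ha.adj₂) (hc.vertex_ne_second ha.adj₁)
    (hc.first_ne_first ha.adj₁ ha.adj₂ ha.ne₁₂) (hc.first_ne_second ha.adj₁ ha.adj₁)
    (hc.first_ne_second ha.adj₂ ha.adj₁)
    (hc.adj_ne ha.adj₂) ?_ (hc.vertex_ne_second ha.adj₂.symm).symm ?_
    (hc.vertex_ne_first ha.adj₃) (hc.first_ne_first ha.adj₁ ha.adj₃ ha.ne₁₃)
    (hc.first_ne_first ha.adj₂ ha.adj₃ ha.ne₂₃) (hc.first_ne_second ha.adj₃ ha.adj₁).symm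
  · exact hbc ▸ (hc.vertex_ne_first hb.adj₂.symm).symm
  · exact hac ▸ (hc.vertex_ne_first ha.adj₂.symm).symm

theorem IsViColoring.not_containsSub_graphG1 (hc : G.IsViColoring 5 cV cI) :
    ¬ G.ContainsSub graphG1 := by
  rintro ⟨f, hf, hadj⟩
  have adj (i j : Fin 4) (h : graphG1.Adj i j) : G.Adj (f i) (f j) := hadj h
  have ha : G.HasThreeNeighbors (f 0) (f 1) (f 2) (f 3) := by
    constructor <;> first | exact hf.ne (by decide) | exact adj _ _ (by simp [graphG1])
  have hb : G.HasThreeNeighbors (f 1) (f 0) (f 2) (f 3) := by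
    constructor <;> first | exact hf.ne (by decide) | exact adj _ _ (by simp [graphG1])
  have ha' : G.HasThreeNeighbors (f 0) (f 1) (f 3) (f 2) :=
    ⟨ha.1, ha.3, ha.2, ha.5, ha.4, ha.6.symm⟩
  have hb' : G.HasThreeNeighbors (f 1) (f 0) (f 3) (f 2) :=
    ⟨hb.1, hb.3, hb.2, hb.5, hb.4, hb.6.symm⟩
  have h2 := hc.vertex_eq_first_of_triangle ha hb
  have h3 := hc.vertex_eq_first_of_triangle ha' hb'
  refine hc.adj_ne ha.adj₁ (eq_of_ne_four (cV (f 2)) (cV (f 3))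
    (cI (f 0) s(f 0, f 1)) (cI (f 1) s(f 1, f 0)) _ _ ?_ ?_ ?_ ?_ ?_
    (hc.first_ne_second ha.adj₁ ha.adj₁)
    (hc.adj_ne ha.adj₂.symm) (hc.adj_ne ha.adj₃.symm) (hc.vertex_ne_first ha.adj₁).symm
    (hc.vertex_ne_second ha.adj₁).symm
    (hc.adj_ne hb.adj₂.symm) (hc.adj_ne hb.adj₃.symm) (hc.vertex_ne_second hb.adj₁).symm
    (hc.vertex_ne_first hb.adj₁).symm)
  · rw [h2, h3]
    exact hc.first_ne_first ha.adj₃ ha.adj₂ ha.ne₂₃.symm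
  · rw [h2]
    exact hc.first_ne_first ha.adj₃ ha.adj₁ ha.ne₁₃.symm
  · rw [h2]
    exact hc.first_ne_second ha.adj₃ ha.adj₁
  · rw [h3]
    exact hc.first_ne_first ha.adj₂ ha.adj₁ ha.ne₁₂.symm
  · rw [h3]
    exact hc.first_ne_second ha.adj₂ ha.adj₁

theorem IsViColoring.not_containsSub_graphG2 (hc : G.IsViColoring 5 cV cI) :
    ¬ G.ContainsSub graphG2 := by
  rintro ⟨f, hf, hadj⟩
  have adj (i j : Fin 6) (h : graphG2.Adj i j) : G.Adj (f i) (f j) := hadj h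
  have hab : G.HasThreeNeighbors (f 0) (f 1) (f 2) (f 4) := by
    constructor <;> first | exact hf.ne (by decide) | exact adj _ _ (by simp [graphG2])
  have hb : G.HasThreeNeighbors (f 1) (f 0) (f 2) (f 5) := by
    constructor <;> first | exact hf.ne (by decide) | exact adj _ _ (by simp [graphG2])
  have hac : G.HasThreeNeighbors (f 0) (f 2) (f 1) (f 4) := by
    constructor <;> first | exact hf.ne (by decide) | exact adj _ _ (by simp [graphG2])
  have hd : G.HasThreeNeighbors (f 2) (f 0) (f 1) (f 3) := by
    constructor <;> first | exact hf.ne (by decide) | exact adj _ _ (by simp [graphG2])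
  exact hc.adj_ne hb.adj₂ ((hc.vertex_eq_first_of_triangle hac hd).trans
    (hc.vertex_eq_first_of_triangle hab hb).symm)

theorem IsViColoring.not_containsSub_graphG3 (hc : G.IsViColoring 5 cV cI) :
    ¬ G.ContainsSub graphG3 := by
  rintro ⟨f, hf, hadj⟩
  have adj (i j : Fin 6) (h : graphG3.Adj i j) : G.Adj (f i) (f j) := hadj h
  have ha : G.HasThreeNeighbors (f 0) (f 1) (f 2) (f 3) := by
    constructor <;> first | exact hf.ne (by decide) | exact adj _ _ (by simp [graphG3])
  have hb : G.HasThreeNeighbors (f 1) (f 0) (f 2) (f 4) := by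
    constructor <;> first | exact hf.ne (by decide) | exact adj _ _ (by simp [graphG3])
  have he : G.HasThreeNeighbors (f 4) (f 1) (f 3) (f 5) := by
    constructor <;> first | exact hf.ne (by decide) | exact adj _ _ (by simp [graphG3])
  exact hc.first_ne_second he.adj₂.symm ha.adj₃.symm
    ((hc.second_eq_second he he.adj₂ he.adj₁).trans
      ((hc.vertex_eq_first_of_triangle hb ha).symm.trans (hc.vertex_eq_first_of_triangle ha hb)))

theorem IsViColoring.not_containsSub_graphG4 (hc : G.IsViColoring 5 cV cI) :
    ¬ G.ContainsSub graphG4 := by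
  rintro ⟨f, hf, hadj⟩
  have adj (i j : Fin 8) (h : graphG4.Adj i j) : G.Adj (f i) (f j) := hadj h
  have ha : G.HasThreeNeighbors (f 0) (f 1) (f 2) (f 3) := by
    constructor <;> first | exact hf.ne (by decide) | exact adj _ _ (by simp [graphG4])
  have hb : G.HasThreeNeighbors (f 1) (f 0) (f 2) (f 4) := by
    constructor <;> first | exact hf.ne (by decide) | exact adj _ _ (by simp [graphG4])
  have hd : G.HasThreeNeighbors (f 3) (f 0) (f 5) (f 6) := by
    constructor <;> first | exact hf.ne (by decide) | exact adj _ _ (by simp [graphG4])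
  have he : G.HasThreeNeighbors (f 4) (f 1) (f 5) (f 7) := by
    constructor <;> first | exact hf.ne (by decide) | exact adj _ _ (by simp [graphG4])
  refine hc.first_ne_first hd.adj₂.symm he.adj₂.symm (hf.ne (by decide)) ?_
  calc cI (f 5) s(f 5, f 3) = cI (f 0) s(f 0, f 3) := hc.second_eq_second hd hd.adj₂ hd.adj₁
    _ = cV (f 2) := (hc.vertex_eq_first_of_triangle ha hb).symm
    _ = cI (f 1) s(f 1, f 4) := hc.vertex_eq_first_of_triangle hb ha
    _ = cI (f 5) s(f 5, f 4) := hc.second_eq_second he he.adj₁ he.adj₂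

end FiveColors

section ChiVi

variable {G : SimpleGraph V}

theorem IsViColoring.castLE {k l : ℕ} (hkl : k ≤ l) {cV : V → Fin k} {cI : V → Sym2 V → Fin k}
    (hc : G.IsViColoring k cV cI) :
    G.IsViColoring l (fun v => (cV v).castLE hkl) (fun v e => (cI v e).castLE hkl) where
  adj_ne _ _ h := (Fin.castLE_injective hkl).ne (hc.adj_ne h)
  vertex_inc_ne _ _ _ h hu := (Fin.castLE_injective hkl).ne (hc.vertex_inc_ne h hu)
  inc_ne _ _ _ _ h h' hne hadj := (Fin.castLE_injective hkl).ne (hc.inc_ne h h' hne hadj)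

theorem exists_isViColoring [Finite V] (G : SimpleGraph V) :
    ∃ k cV cI, G.IsViColoring k cV cI := by
  obtain ⟨k, ⟨φ⟩⟩ := Finite.exists_equiv_fin (V ⊕ V × Sym2 V)
  refine ⟨k, fun v => φ (.inl v), fun v e => φ (.inr (v, e)), ?_, ?_, ?_⟩
  · exact fun u v h => φ.injective.ne (Sum.inl_injective.ne h.ne)
  · exact fun _ _ _ _ _ => φ.injective.ne Sum.inl_ne_inr
  · exact fun _ _ _ _ _ _ h _ => φ.injective.ne (Sum.inr_injective.ne h)

theorem lt_chiVi [Finite V] {k : ℕ} (h : ¬ ∃ cV cI, G.IsViColoring k cV cI) : k < G.chiVi := by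
  refine le_csInf (exists_isViColoring G) fun l ⟨cV, cI, hc⟩ => ?_
  by_contra! hl
  exact h ⟨_, _, hc.castLE (Nat.le_of_lt_succ hl)⟩

end ChiVi

/-- Among three neighbors of a vertex `x` of a linearly ordered graph, two lie on the same side
of `x`. -/
theorem exists_adj_between [LinearOrder V] {G : SimpleGraph V} {x : V}
    (hx : (G.neighborSet x).ncard = 3) :
    ∃ y z, G.Adj x y ∧ (y < z ∧ z < x ∨ x < z ∧ z < y) := by
  obtain ⟨p, q, r, hpq, hpr, hqr, h⟩ := Set.ncard_eq_three.1 hx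
  have hp : G.Adj x p := by simp [← mem_neighborSet, h]
  have hq : G.Adj x q := by simp [← mem_neighborSet, h]
  have hr : G.Adj x r := by simp [← mem_neighborSet, h]
  by_contra! hcon
  have h1 := hcon p q hp
  have h2 := hcon p r hp
  have h3 := hcon q p hq
  have h4 := hcon q r hq
  have h5 := hcon r p hr
  have h6 := hcon r q hr
  clear hcon h hx
  rcases hp.ne.lt_or_gt with hp | hp <;> rcases hq.ne.lt_or_gt with hq | hq <;>
    rcases hr.ne.lt_or_gt with hr | hr <;> rcases hpq.lt_or_gt with hpq | hpq <;>
    rcases hpr.lt_or_gt with hpr | hpr <;> rcases hqr.lt_or_gt with hqr | hqr <;> grind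

/-- A nonempty finite outerplanar graph is not cubic. -/
theorem Outerplanar.not_cubic [Finite V] [Nonempty V] {G : SimpleGraph V} (ho : G.Outerplanar) :
    ¬ ∀ v, (G.neighborSet v).ncard = 3 := by
  intro hcubic
  obtain ⟨r, hr⟩ := ho
  have key : ∀ (n : ℕ) (a b x : V), G.Adj a b → a < x → x < b → (Set.Ioo a b).ncard ≠ n := by
    intro n
    induction n using Nat.strong_induction_on with
    | _ n ih =>
      rintro a b x hab hax hxb rfl
      obtain ⟨y, z, hxy, h⟩ := exists_adj_between (hcubic x)
      have hay : a ≤ y := not_lt.1 fun hya => hr y x a b hxy.symm hab ⟨hya, hax, hxb⟩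
      have hyb : y ≤ b := not_lt.1 fun hby => hr a b x y hab hxy ⟨hax, hxb, hby⟩
      have hmem : x ∈ Set.Ioo a b := ⟨hax, hxb⟩
      rcases h with ⟨hyz, hzx⟩ | ⟨hxz, hzy⟩
      · refine ih _ (Set.ncard_lt_ncard ?_) y x z hxy.symm hyz hzx rfl
        exact (Set.ssubset_iff_of_subset (Set.Ioo_subset_Ioo hay hxb.le)).2
          ⟨x, hmem, Set.right_notMem_Ioo⟩
      · refine ih _ (Set.ncard_lt_ncard ?_) x y z hxy hxz hzy rfl
        exact (Set.ssubset_iff_of_subset (Set.Ioo_subset_Ioo hax.le hyb)).2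
          ⟨x, hmem, Set.left_notMem_Ioo⟩
  obtain ⟨y, z, hxy, h⟩ := exists_adj_between (hcubic (Classical.arbitrary V))
  rcases h with ⟨hyz, hzx⟩ | ⟨hxz, hzy⟩
  · exact key _ _ _ _ hxy.symm hyz hzx rfl
  · exact key _ _ _ _ hxy hxz hzy rfl

end SimpleGraph

/-- Any finite simple graph containing one of `G₁, G₂, G₃, G₄` as a subgraph admits no
vi-simultaneous proper 5-coloring, so `χ_vi(G) ≥ 6`; in particular every outerplanar cubic
such graph satisfies `χ_vi(G) = 6`. -/
theorem not_viColorable_five_of_contains {W : Type*} [Fintype W] (G : SimpleGraph W)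
    (h : G.ContainsSub graphG1 ∨ G.ContainsSub graphG2 ∨
         G.ContainsSub graphG3 ∨ G.ContainsSub graphG4) :
    (¬ ∃ cV cI, G.IsViColoring 5 cV cI) ∧ 6 ≤ G.chiVi ∧
    (G.Outerplanar → (∀ v, (G.neighborSet v).ncard = 3) → G.chiVi = 6) := by
  have hfive : ¬ ∃ cV cI, G.IsViColoring 5 cV cI := by
    rintro ⟨cV, cI, hc⟩
    rcases h with h | h | h | h
    · exact hc.not_containsSub_graphG1 h
    · exact hc.not_containsSub_graphG2 h
    · exact hc.not_containsSub_graphG3 h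
    · exact hc.not_containsSub_graphG4 h
  refine ⟨hfive, lt_chiVi hfive, fun ho hcubic => ?_⟩
  have : Nonempty W := by
    rcases h with ⟨f, -⟩ | ⟨f, -⟩ | ⟨f, -⟩ | ⟨f, -⟩ <;> exact ⟨f 0⟩
  exact absurd hcubic ho.not_cubic
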